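/- arXiv:1802.06563 — 3 statements merged into one kernel-verified Lean document; each statement's English description precedes it below -/
import Mathlib

section
/- Let d ≥ 1 be an integer and let σ₁, σ₂, σ₃ ∈ ℝ \ {0} satisfy (σ₁+σ₂)(σ₂+σ₃)(σ₃+σ₁) ≠ 0. Then there exist constants ε > 0 and c > 0, depending only on σ₁, σ₂, σ₃, such that for all τ₁, τ₂, τ₃ ∈ ℝ and ξ₁, ξ₂, ξ₃ ∈ ℝ^d with τ₁+τ₂+τ₃ = 0 and ξ₁+ξ₂+ξ₃ = 0 the following holds: if there exist indices i, j ∈ {1,2,3} with |ξ_i| ≤ ε·|ξ_j|, then max_{1≤k≤3} |τ_k + σ_k·|ξ_k|²| ≥ c·max_{1≤k≤3} |ξ_k|². -/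
open MeasureTheory

theorem core_aux (a b c s1 s2 s3 m K ε : ℝ) (ha : 0 ≤ a) (hc : 0 ≤ c)
    (hε : 0 < ε) (hε1 : ε < 1) (hK : |s1| + |s2| + |s3| ≤ K) (hm : m ≤ |s2 + s3|)
    (hKε : 6 * (K * ε) ≤ m) (h1 : a ≤ ε * b) (h2 : c ≤ b) (h3 : b ≤ a + c) :
    m / 2 * b ^ 2 ≤ |s1 * a ^ 2 + s2 * b ^ 2 + s3 * c ^ 2| := by
  have hb : 0 ≤ b := hc.trans h2
  have e : (s2 + s3) * b ^ 2 = (s1 * a ^ 2 + s2 * b ^ 2 + s3 * c ^ 2) - s1 * a ^ 2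
      + s3 * (b ^ 2 - c ^ 2) := by ring
  have t1 : |(s2 + s3) * b ^ 2| ≤ |s1 * a ^ 2 + s2 * b ^ 2 + s3 * c ^ 2| + |s1 * a ^ 2|
      + |s3 * (b ^ 2 - c ^ 2)| := by
    rw [e]
    exact (abs_add_le _ _).trans (by gcongr; exact abs_sub _ _)
  have hd : 0 ≤ b ^ 2 - c ^ 2 := by nlinarith
  rw [abs_mul, abs_mul s1, abs_mul s3, abs_of_nonneg (sq_nonneg b), abs_of_nonneg (sq_nonneg a),
    abs_of_nonneg hd] at t1
  have u0 : a ≤ b := by nlinarith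
  have u1 : a ^ 2 ≤ ε * b ^ 2 := by nlinarith
  have u2 : b ^ 2 - c ^ 2 ≤ 2 * (ε * b ^ 2) := by nlinarith
  have hp : 0 ≤ ε * b ^ 2 := by positivity
  have v1 : |s1| * a ^ 2 ≤ K * (ε * b ^ 2) :=
    mul_le_mul (by linarith [abs_nonneg s2, abs_nonneg s3]) u1 (sq_nonneg a)
      (by linarith [abs_nonneg s1, abs_nonneg s2, abs_nonneg s3])
  have v2 : |s3| * (b ^ 2 - c ^ 2) ≤ K * (2 * (ε * b ^ 2)) :=
    mul_le_mul (by linarith [abs_nonneg s2, abs_nonneg s1]) u2 hd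
      (by linarith [abs_nonneg s1, abs_nonneg s2, abs_nonneg s3])
  have v3 : m * b ^ 2 ≤ |s2 + s3| * b ^ 2 := by gcongr
  have v4 : 6 * (K * ε) * b ^ 2 ≤ m * b ^ 2 := by gcongr
  nlinarith

theorem core_aux2 (a b c M s1 s2 s3 m K ε : ℝ) (ha : 0 ≤ a) (hb : 0 ≤ b) (hc : 0 ≤ c)
    (hε : 0 < ε) (hε1 : ε < 1) (hK : |s1| + |s2| + |s3| ≤ K) (hm : m ≤ |s2 + s3|)
    (hKε : 6 * (K * ε) ≤ m) (h1 : a ≤ ε * M) (hbM : b ≤ M) (hcM : c ≤ M)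
    (h2 : b ≤ a + c) (h3 : c ≤ a + b) (hM : M = a ∨ M = b ∨ M = c) :
    m / 2 * M ^ 2 ≤ |s1 * a ^ 2 + s2 * b ^ 2 + s3 * c ^ 2| := by
  rcases hM with rfl | rfl | rfl
  · have : M = 0 := by nlinarith
    subst this
    simp
  · exact core_aux a M c s1 s2 s3 m K ε ha hc hε hε1 hK hm hKε h1 hcM h2
  · have := core_aux a M b s1 s3 s2 m K ε ha hb hε hε1 (by linarith) (by rwa [add_comm])
      hKε h1 hbM h3
    rwa [show s1 * a ^ 2 + s2 * b ^ 2 + s3 * M ^ 2 = s1 * a ^ 2 + s3 * M ^ 2 + s2 * b ^ 2 by ring]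

theorem norm_aux {E : Type*} [NormedAddCommGroup E] (x y z : E) (h : x + y + z = 0) :
    ‖x‖ ≤ ‖y‖ + ‖z‖ := by
  have : x = -(y + z) := by
    rw [eq_neg_iff_add_eq_zero, ← add_assoc, h]
  rw [this, norm_neg]
  exact norm_add_le _ _

/-- Modulation lower bound (Lemma 4.1 of Hirayama): if two of the three
frequencies have very different sizes, the maximal modulation dominates the
square of the maximal frequency. -/
theorem modulation_lower_bound
    (d : ℕ) (hd : 1 ≤ d) (σ₁ σ₂ σ₃ : ℝ)
    (hσ₁ : σ₁ ≠ 0) (hσ₂ : σ₂ ≠ 0) (hσ₃ : σ₃ ≠ 0)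
    (hsum : (σ₁ + σ₂) * (σ₂ + σ₃) * (σ₃ + σ₁) ≠ 0) :
    ∃ ε > (0:ℝ), ∃ c > (0:ℝ),
      ∀ (τ₁ τ₂ τ₃ : ℝ) (ξ₁ ξ₂ ξ₃ : EuclideanSpace ℝ (Fin d)),
        τ₁ + τ₂ + τ₃ = 0 → ξ₁ + ξ₂ + ξ₃ = 0 →
        (∃ ξi ∈ ({ξ₁, ξ₂, ξ₃} : Set (EuclideanSpace ℝ (Fin d))),
         ∃ ξj ∈ ({ξ₁, ξ₂, ξ₃} : Set (EuclideanSpace ℝ (Fin d))),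
           ‖ξi‖ ≤ ε * ‖ξj‖) →
        c * max (‖ξ₁‖ ^ 2) (max (‖ξ₂‖ ^ 2) (‖ξ₃‖ ^ 2)) ≤
          max (|τ₁ + σ₁ * ‖ξ₁‖ ^ 2|)
            (max (|τ₂ + σ₂ * ‖ξ₂‖ ^ 2|) (|τ₃ + σ₃ * ‖ξ₃‖ ^ 2|)) := by
  have hs : (σ₁ + σ₂ ≠ 0 ∧ σ₂ + σ₃ ≠ 0) ∧ σ₃ + σ₁ ≠ 0 := by
    simpa [mul_ne_zero_iff] using hsum
  obtain ⟨⟨h12, h23⟩, h31⟩ := hs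
  obtain ⟨m, hm0, m12, m23, m31⟩ : ∃ m > (0:ℝ), m ≤ |σ₁ + σ₂| ∧ m ≤ |σ₂ + σ₃| ∧ m ≤ |σ₃ + σ₁| :=
    ⟨min |σ₁ + σ₂| (min |σ₂ + σ₃| |σ₃ + σ₁|),
      lt_min (abs_pos.2 h12) (lt_min (abs_pos.2 h23) (abs_pos.2 h31)),
      min_le_left _ _, (min_le_right _ _).trans (min_le_left _ _),
      (min_le_right _ _).trans (min_le_right _ _)⟩
  obtain ⟨K, hK⟩ : ∃ K, K = |σ₁| + |σ₂| + |σ₃| := ⟨_, rfl⟩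
  have p1 := abs_pos.2 hσ₁
  have p2 := abs_pos.2 hσ₂
  have p3 := abs_pos.2 hσ₃
  have hK0 : 0 < K := by rw [hK]; positivity
  have hmK : m ≤ K := by linarith [abs_add_le σ₁ σ₂]
  obtain ⟨ε, hεd⟩ : ∃ ε, ε = m / (6 * K) := ⟨_, rfl⟩
  have hε : 0 < ε := by rw [hεd]; positivity
  have hKε' : 6 * (K * ε) = m := by rw [hεd]; field_simp
  have hKε := hKε'.le
  have hε1 : ε < 1 := by nlinarith
  refine ⟨ε, hε, m / 6, by positivity, ?_⟩
  intro τ₁ τ₂ τ₃ ξ₁ ξ₂ ξ₃ hτ hξ ⟨x, hx, y, hy, hxy⟩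
  have n1 := norm_aux ξ₁ ξ₂ ξ₃ hξ
  have n2 := norm_aux ξ₂ ξ₁ ξ₃ (by rw [← hξ]; abel)
  have n3 := norm_aux ξ₃ ξ₁ ξ₂ (by rw [← hξ]; abel)
  have a1 := norm_nonneg ξ₁
  have a2 := norm_nonneg ξ₂
  have a3 := norm_nonneg ξ₃
  obtain ⟨M, hM1, hM2, hM3, hM⟩ : ∃ M, ‖ξ₁‖ ≤ M ∧ ‖ξ₂‖ ≤ M ∧ ‖ξ₃‖ ≤ M ∧
      (M = ‖ξ₁‖ ∨ M = ‖ξ₂‖ ∨ M = ‖ξ₃‖) := by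
    refine ⟨max ‖ξ₁‖ (max ‖ξ₂‖ ‖ξ₃‖), by simp, by simp, by simp, ?_⟩
    rcases max_choice ‖ξ₁‖ (max ‖ξ₂‖ ‖ξ₃‖) with h | h
    · exact Or.inl h
    · rw [h]
      exact Or.inr (max_choice _ _)
  have hyM : ‖y‖ ≤ M := by
    rcases hy with rfl | rfl | rfl <;> assumption
  have hxM : ‖x‖ ≤ ε * M := hxy.trans (by gcongr)
  have key : m / 2 * M ^ 2 ≤ |σ₁ * ‖ξ₁‖ ^ 2 + σ₂ * ‖ξ₂‖ ^ 2 + σ₃ * ‖ξ₃‖ ^ 2| := by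
    rcases hx with rfl | rfl | rfl
    · exact core_aux2 _ _ _ M σ₁ σ₂ σ₃ m K ε a1 a2 a3 hε hε1 (by linarith) m23 hKε hxM hM2 hM3
        n2 n3 hM
    · have := core_aux2 _ _ _ M σ₂ σ₁ σ₃ m K ε a2 a1 a3 hε hε1 (by linarith)
        (by rwa [add_comm σ₁]) hKε hxM hM1 hM3 n1 (by linarith) (by tauto)
      rwa [add_comm (σ₁ * _)]
    · have := core_aux2 _ _ _ M σ₃ σ₁ σ₂ m K ε a3 a1 a2 hε hε1 (by linarith)
        m12 hKε hxM hM1 hM2 (by linarith) (by linarith) (by tauto)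
      rwa [add_comm (σ₁ * _ + _), ← add_assoc]
  have q : max (‖ξ₁‖ ^ 2) (max (‖ξ₂‖ ^ 2) (‖ξ₃‖ ^ 2)) ≤ M ^ 2 :=
    max_le (by gcongr) (max_le (by gcongr) (by gcongr))
  have q' := mul_le_mul_of_nonneg_left q (by positivity : 0 ≤ m / 6)
  have e : σ₁ * ‖ξ₁‖ ^ 2 + σ₂ * ‖ξ₂‖ ^ 2 + σ₃ * ‖ξ₃‖ ^ 2 =
      (τ₁ + σ₁ * ‖ξ₁‖ ^ 2) + (τ₂ + σ₂ * ‖ξ₂‖ ^ 2) + (τ₃ + σ₃ * ‖ξ₃‖ ^ 2) := by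
    linear_combination -hτ
  rw [e] at key
  have t := abs_add_three (τ₁ + σ₁ * ‖ξ₁‖ ^ 2) (τ₂ + σ₂ * ‖ξ₂‖ ^ 2) (τ₃ + σ₃ * ‖ξ₃‖ ^ 2)
  have w1 := le_max_left |τ₁ + σ₁ * ‖ξ₁‖ ^ 2|
    (max (|τ₂ + σ₂ * ‖ξ₂‖ ^ 2|) (|τ₃ + σ₃ * ‖ξ₃‖ ^ 2|))
  have w := le_max_right |τ₁ + σ₁ * ‖ξ₁‖ ^ 2|
    (max (|τ₂ + σ₂ * ‖ξ₂‖ ^ 2|) (|τ₃ + σ₃ * ‖ξ₃‖ ^ 2|))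
  have w2 := (le_max_left |τ₂ + σ₂ * ‖ξ₂‖ ^ 2| |τ₃ + σ₃ * ‖ξ₃‖ ^ 2|).trans w
  have w3 := (le_max_right |τ₂ + σ₂ * ‖ξ₂‖ ^ 2| |τ₃ + σ₃ * ‖ξ₃‖ ^ 2|).trans w
  linarith
end

section
/- Let d ≥ 1 be an integer and let σ₁, σ₂, σ₃ ∈ ℝ \ {0} satisfy (σ₁+σ₂)(σ₂+σ₃)(σ₃+σ₁) ≠ 0. Then there exist constants ε > 0 and C ≥ 1, depending only on σ₁, σ₂, σ₃, such that for all τ₁, τ₂, τ₃ ∈ ℝ and ξ₁, ξ₂, ξ₃ ∈ ℝ^d with τ₁+τ₂+τ₃ = 0 and ξ₁+ξ₂+ξ₃ = 0 the following holds: if max_{1≤k≤3} |τ_k + σ_k·|ξ_k|²| ≤ ε·max_{1≤k≤3} |ξ_k|², then |ξ_i| ≤ C·|ξ_j| for all i, j ∈ {1,2,3} (i.e. |ξ₁| ∼ |ξ₂| ∼ |ξ₃|). -/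
open MeasureTheory

/-- If the third frequency size `c` were much smaller than the maximum `M`, the resonance function
would be bounded below by a multiple of `M ^ 2`. -/
lemma key_resonance (s₁ s₂ s₃ : ℝ) (h : s₁ + s₂ ≠ 0) :
    ∃ ε > (0:ℝ), ∃ C : ℝ, 1 ≤ C ∧ ∀ a b c M : ℝ, 0 ≤ a → 0 ≤ b → 0 ≤ c →
      a ≤ b + c → b ≤ a + c → a ≤ M → b ≤ M → c ≤ M → (M = a ∨ M = b ∨ M = c) →
      |s₁ * a ^ 2 + s₂ * b ^ 2 + s₃ * c ^ 2| ≤ 3 * ε * M ^ 2 → M ≤ C * c := by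
  have hS : 0 < |s₁ + s₂| := abs_pos.mpr h
  have hK : 0 ≤ 2 * |s₂| + |s₃| := by positivity
  refine ⟨|s₁ + s₂| / 24, by positivity, 2 + 16 * (2 * |s₂| + |s₃|) / |s₁ + s₂|, ?_, ?_⟩
  · have : 0 ≤ 16 * (2 * |s₂| + |s₃|) / |s₁ + s₂| := by positivity
    linarith
  intro a b c M ha hb hc hab hba haM hbM hcM hM hR
  by_contra! hlt
  have hq : 0 ≤ 16 * (2 * |s₂| + |s₃|) / |s₁ + s₂| * c := by positivity
  have h2 : 2 * c < M := by nlinarith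
  have hM0 : 0 < M := by linarith
  have haM2 : M / 2 ≤ a := by rcases hM with h | h | h <;> linarith
  have hlt' : 16 * (2 * |s₂| + |s₃|) * c < |s₁ + s₂| * M := by
    have h3 : 16 * (2 * |s₂| + |s₃|) / |s₁ + s₂| * c < M := by nlinarith
    have h4 := mul_lt_mul_of_pos_left h3 hS
    have h5 : |s₁ + s₂| * (16 * (2 * |s₂| + |s₃|) / |s₁ + s₂| * c)
        = 16 * (2 * |s₂| + |s₃|) * c := by field_simp
    linarith
  have hd : |b ^ 2 - a ^ 2| ≤ 2 * (c * M) := by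
    rw [abs_le]; constructor <;> nlinarith [mul_nonneg hc hM0.le]
  have e1 : |s₁ + s₂| * a ^ 2 ≤ |s₁ * a ^ 2 + s₂ * b ^ 2 + s₃ * c ^ 2|
      + |s₂| * |b ^ 2 - a ^ 2| + |s₃| * c ^ 2 := by
    have : (s₁ + s₂) * a ^ 2 = (s₁ * a ^ 2 + s₂ * b ^ 2 + s₃ * c ^ 2)
      - s₂ * (b ^ 2 - a ^ 2) - s₃ * c ^ 2 := by ring
    calc |s₁ + s₂| * a ^ 2 = |(s₁ + s₂) * a ^ 2| := by rw [abs_mul, abs_of_nonneg (sq_nonneg a)]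
      _ ≤ _ := by
        rw [this]
        refine (abs_sub _ _).trans ?_
        rw [abs_mul s₃, abs_of_nonneg (sq_nonneg c)]
        gcongr
        refine (abs_sub _ _).trans ?_
        rw [abs_mul]
  have e2 := mul_le_mul_of_nonneg_left hd (abs_nonneg s₂)
  have e3 : |s₃| * c ^ 2 ≤ |s₃| * (c * M) := by gcongr; nlinarith
  have e4 : |s₁ + s₂| * (M / 2) ^ 2 ≤ |s₁ + s₂| * a ^ 2 := by gcongr
  have e5 := mul_lt_mul_of_pos_right hlt' hM0
  have e6 : 0 ≤ (2 * |s₂| + |s₃|) * (c * M) := by positivity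
  nlinarith

set_option maxHeartbeats 2000000 in
/-- Lemma 2.5 of the paper ('modul_est_2'): in the low-modulation regime all
three frequencies are comparable. -/
theorem low_modulation_comparable_frequencies
    (d : ℕ) (hd : 1 ≤ d) (σ₁ σ₂ σ₃ : ℝ)
    (hσ₁ : σ₁ ≠ 0) (hσ₂ : σ₂ ≠ 0) (hσ₃ : σ₃ ≠ 0)
    (hsum : (σ₁ + σ₂) * (σ₂ + σ₃) * (σ₃ + σ₁) ≠ 0) :
    ∃ ε > (0:ℝ), ∃ C : ℝ, 1 ≤ C ∧
      ∀ (τ₁ τ₂ τ₃ : ℝ) (ξ₁ ξ₂ ξ₃ : EuclideanSpace ℝ (Fin d)),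
        τ₁ + τ₂ + τ₃ = 0 → ξ₁ + ξ₂ + ξ₃ = 0 →
        max (|τ₁ + σ₁ * ‖ξ₁‖ ^ 2|)
            (max (|τ₂ + σ₂ * ‖ξ₂‖ ^ 2|) (|τ₃ + σ₃ * ‖ξ₃‖ ^ 2|)) ≤
          ε * max (‖ξ₁‖ ^ 2) (max (‖ξ₂‖ ^ 2) (‖ξ₃‖ ^ 2)) →
        ∀ ξi ∈ ({ξ₁, ξ₂, ξ₃} : Set (EuclideanSpace ℝ (Fin d))),
        ∀ ξj ∈ ({ξ₁, ξ₂, ξ₃} : Set (EuclideanSpace ℝ (Fin d))),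
          ‖ξi‖ ≤ C * ‖ξj‖ := by
  have h12 : σ₁ + σ₂ ≠ 0 := fun h => hsum (by rw [h]; ring)
  have h23 : σ₂ + σ₃ ≠ 0 := fun h => hsum (by rw [h]; ring)
  have h31 : σ₃ + σ₁ ≠ 0 := fun h => hsum (by rw [h]; ring)
  obtain ⟨e₃, he₃, C₃, hC₃, k₃⟩ := key_resonance σ₁ σ₂ σ₃ h12
  obtain ⟨e₁, he₁, C₁, hC₁, k₁⟩ := key_resonance σ₂ σ₃ σ₁ h23
  obtain ⟨e₂, he₂, C₂, hC₂, k₂⟩ := key_resonance σ₃ σ₁ σ₂ h31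
  refine ⟨min e₁ (min e₂ e₃), by positivity, max C₁ (max C₂ C₃), le_max_of_le_left hC₁, ?_⟩
  intro τ₁ τ₂ τ₃ ξ₁ ξ₂ ξ₃ hτ hξ hmax
  have t₁ : ‖ξ₁‖ ≤ ‖ξ₂‖ + ‖ξ₃‖ := by
    have : ξ₁ = -(ξ₂ + ξ₃) := by rw [eq_neg_iff_add_eq_zero, ← hξ]; abel
    rw [this, norm_neg]; exact norm_add_le _ _
  have t₂ : ‖ξ₂‖ ≤ ‖ξ₃‖ + ‖ξ₁‖ := by
    have : ξ₂ = -(ξ₃ + ξ₁) := by rw [eq_neg_iff_add_eq_zero, ← hξ]; abel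
    rw [this, norm_neg]; exact norm_add_le _ _
  have t₃ : ‖ξ₃‖ ≤ ‖ξ₁‖ + ‖ξ₂‖ := by
    have : ξ₃ = -(ξ₁ + ξ₂) := by rw [eq_neg_iff_add_eq_zero, ← hξ]; abel
    rw [this, norm_neg]; exact norm_add_le _ _
  have n₁ := norm_nonneg ξ₁
  have n₂ := norm_nonneg ξ₂
  have n₃ := norm_nonneg ξ₃
  obtain ⟨M, m₁, m₂, m₃, hM⟩ : ∃ M : ℝ, ‖ξ₁‖ ≤ M ∧ ‖ξ₂‖ ≤ M ∧ ‖ξ₃‖ ≤ M ∧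
      (M = ‖ξ₁‖ ∨ M = ‖ξ₂‖ ∨ M = ‖ξ₃‖) := by
    refine ⟨max ‖ξ₁‖ (max ‖ξ₂‖ ‖ξ₃‖), by simp, by simp, by simp, ?_⟩
    grind
  have hMM : max (‖ξ₁‖ ^ 2) (max (‖ξ₂‖ ^ 2) (‖ξ₃‖ ^ 2)) ≤ M ^ 2 :=
    max_le (by gcongr) (max_le (by gcongr) (by gcongr))
  have hR : |σ₁ * ‖ξ₁‖ ^ 2 + σ₂ * ‖ξ₂‖ ^ 2 + σ₃ * ‖ξ₃‖ ^ 2|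
      ≤ 3 * (min e₁ (min e₂ e₃) * M ^ 2) := by
    have hmax' := hmax.trans (mul_le_mul_of_nonneg_left hMM
      (by positivity : 0 ≤ min e₁ (min e₂ e₃)))
    rw [max_le_iff, max_le_iff, abs_le, abs_le, abs_le] at hmax'
    obtain ⟨⟨_, _⟩, ⟨_, _⟩, ⟨_, _⟩⟩ := hmax'
    rw [abs_le]; constructor <;> linarith
  have l₁ : min e₁ (min e₂ e₃) * M ^ 2 ≤ e₁ * M ^ 2 := by gcongr; simp
  have l₂ : min e₁ (min e₂ e₃) * M ^ 2 ≤ e₂ * M ^ 2 := by gcongr; simp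
  have l₃ : min e₁ (min e₂ e₃) * M ^ 2 ≤ e₃ * M ^ 2 := by gcongr; simp
  have r₃ := k₃ ‖ξ₁‖ ‖ξ₂‖ ‖ξ₃‖ M n₁ n₂ n₃ (by linarith) (by linarith) m₁ m₂ m₃ hM
    (by linarith)
  have r₁ := k₁ ‖ξ₂‖ ‖ξ₃‖ ‖ξ₁‖ M n₂ n₃ n₁ (by linarith) (by linarith) m₂ m₃ m₁ (by tauto)
    (by rw [show σ₂ * ‖ξ₂‖ ^ 2 + σ₃ * ‖ξ₃‖ ^ 2 + σ₁ * ‖ξ₁‖ ^ 2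
          = σ₁ * ‖ξ₁‖ ^ 2 + σ₂ * ‖ξ₂‖ ^ 2 + σ₃ * ‖ξ₃‖ ^ 2 by ring]; linarith)
  have r₂ := k₂ ‖ξ₃‖ ‖ξ₁‖ ‖ξ₂‖ M n₃ n₁ n₂ (by linarith) (by linarith) m₃ m₁ m₂ (by tauto)
    (by rw [show σ₃ * ‖ξ₃‖ ^ 2 + σ₁ * ‖ξ₁‖ ^ 2 + σ₂ * ‖ξ₂‖ ^ 2
          = σ₁ * ‖ξ₁‖ ^ 2 + σ₂ * ‖ξ₂‖ ^ 2 + σ₃ * ‖ξ₃‖ ^ 2 by ring]; linarith)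
  have hi : ∀ ξ ∈ ({ξ₁, ξ₂, ξ₃} : Set (EuclideanSpace ℝ (Fin d))), ‖ξ‖ ≤ M := by
    rintro ξ (rfl | rfl | rfl) <;> assumption
  have hj : ∀ ξ ∈ ({ξ₁, ξ₂, ξ₃} : Set (EuclideanSpace ℝ (Fin d))),
      M ≤ max C₁ (max C₂ C₃) * ‖ξ‖ := by
    rintro ξ (rfl | rfl | rfl)
    · exact r₁.trans (by gcongr; simp)
    · exact r₂.trans (by gcongr; simp)
    · exact r₃.trans (by gcongr; simp)
  exact fun ξi h h' hh => (hi ξi h).trans (hj h' hh)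
end

section
/- Let σ₁, σ₂, σ₃ ∈ ℝ \ {0} and let ξ₁, ξ₂ ∈ ℝ², with ξ := ξ₁ + ξ₂. Define the unit vectors in ℝ³: n₁ := (1 + 4σ₁²|ξ₁|²)^{−1/2}·(1, 2σ₁ξ₁^{(1)}, 2σ₁ξ₁^{(2)}), n₂ := (1 + 4σ₂²|ξ₂|²)^{−1/2}·(1, 2σ₂ξ₂^{(1)}, 2σ₂ξ₂^{(2)}), n₃ := (1 + 4σ₃²|ξ|²)^{−1/2}·(−1, 2σ₃ξ^{(1)}, 2σ₃ξ^{(2)}). Then the determinant of the 3×3 matrix with columns n₁, n₂, n₃ equals −4·(σ₁σ₂ + σ₂σ₃ + σ₃σ₁)·(ξ₁^{(1)}ξ₂^{(2)} − ξ₁^{(2)}ξ₂^{(1)}) / ( (1+4σ₁²|ξ₁|²)^{1/2} (1+4σ₂²|ξ₂|²)^{1/2} (1+4σ₃²|ξ|²)^{1/2} ). In particular, if θ := σ₁σ₂ + σ₂σ₃ + σ₃σ₁ ≠ 0 and ξ₁, ξ₂ are linearly independent, this determinant is nonzero. -/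
open MeasureTheory

noncomputable section

/-- Determinant identity for the unit normals to the three characteristic
paraboloids (transversality computation in the proof of Proposition 2.9). -/
theorem normal_determinant_identity
    (σ₁ σ₂ σ₃ : ℝ) (hσ₁ : σ₁ ≠ 0) (hσ₂ : σ₂ ≠ 0) (hσ₃ : σ₃ ≠ 0)
    (ξ₁ ξ₂ : EuclideanSpace ℝ (Fin 2)) :
    let ξ : EuclideanSpace ℝ (Fin 2) := ξ₁ + ξ₂
    let n₁ : Fin 3 → ℝ := fun j =>
      (Real.sqrt (1 + 4 * σ₁ ^ 2 * ‖ξ₁‖ ^ 2))⁻¹ *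
        ![1, 2 * σ₁ * ξ₁ 0, 2 * σ₁ * ξ₁ 1] j
    let n₂ : Fin 3 → ℝ := fun j =>
      (Real.sqrt (1 + 4 * σ₂ ^ 2 * ‖ξ₂‖ ^ 2))⁻¹ *
        ![1, 2 * σ₂ * ξ₂ 0, 2 * σ₂ * ξ₂ 1] j
    let n₃ : Fin 3 → ℝ := fun j =>
      (Real.sqrt (1 + 4 * σ₃ ^ 2 * ‖ξ‖ ^ 2))⁻¹ *
        ![-1, 2 * σ₃ * ξ 0, 2 * σ₃ * ξ 1] j
    -- the matrix with columns `n₁, n₂, n₃`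
    let M : Matrix (Fin 3) (Fin 3) ℝ := (Matrix.of ![n₁, n₂, n₃]).transpose
    M.det = -4 * (σ₁ * σ₂ + σ₂ * σ₃ + σ₃ * σ₁) * (ξ₁ 0 * ξ₂ 1 - ξ₁ 1 * ξ₂ 0) /
        (Real.sqrt (1 + 4 * σ₁ ^ 2 * ‖ξ₁‖ ^ 2) *
          Real.sqrt (1 + 4 * σ₂ ^ 2 * ‖ξ₂‖ ^ 2) *
          Real.sqrt (1 + 4 * σ₃ ^ 2 * ‖ξ‖ ^ 2)) ∧
      (σ₁ * σ₂ + σ₂ * σ₃ + σ₃ * σ₁ ≠ 0 → LinearIndependent ℝ ![ξ₁, ξ₂] →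
        M.det ≠ 0) := by
  intro ξ n₁ n₂ n₃ M
  have hpos : ∀ (s : ℝ) (v : EuclideanSpace ℝ (Fin 2)),
      Real.sqrt (1 + 4 * s ^ 2 * ‖v‖ ^ 2) ≠ 0 := by
    intro s v
    have : 0 < 1 + 4 * s ^ 2 * ‖v‖ ^ 2 := by positivity
    exact (Real.sqrt_pos.mpr this).ne'
  have h1 := hpos σ₁ ξ₁
  have h2 := hpos σ₂ ξ₂
  have h3 := hpos σ₃ ξ
  have e0 : ξ 0 = ξ₁ 0 + ξ₂ 0 := rfl
  have e1 : ξ 1 = ξ₁ 1 + ξ₂ 1 := rfl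
  have key : M.det = -4 * (σ₁ * σ₂ + σ₂ * σ₃ + σ₃ * σ₁) * (ξ₁ 0 * ξ₂ 1 - ξ₁ 1 * ξ₂ 0) /
        (Real.sqrt (1 + 4 * σ₁ ^ 2 * ‖ξ₁‖ ^ 2) *
          Real.sqrt (1 + 4 * σ₂ ^ 2 * ‖ξ₂‖ ^ 2) *
          Real.sqrt (1 + 4 * σ₃ ^ 2 * ‖ξ‖ ^ 2)) := by
    rw [Matrix.det_transpose, Matrix.det_fin_three]
    simp only [Matrix.of_apply, Matrix.cons_val, n₁, n₂, n₃, e0, e1]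
    generalize Real.sqrt (1 + 4 * σ₁ ^ 2 * ‖ξ₁‖ ^ 2) = A at *
    generalize Real.sqrt (1 + 4 * σ₂ ^ 2 * ‖ξ₂‖ ^ 2) = B at *
    generalize Real.sqrt (1 + 4 * σ₃ ^ 2 * ‖ξ‖ ^ 2) = C at *
    field_simp
    ring
  refine ⟨key, fun hθ hli => ?_⟩
  rw [key]
  refine div_ne_zero (mul_ne_zero (mul_ne_zero (by norm_num) hθ) ?_)
    (mul_ne_zero (mul_ne_zero h1 h2) h3)
  intro hX
  rw [LinearIndependent.pair_iff] at hli
  have a0 := hli (ξ₂ 0) (-ξ₁ 0) (by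
    ext i; fin_cases i
    · simp; ring
    · simp; linarith)
  have a1 := hli (ξ₂ 1) (-ξ₁ 1) (by
    ext i; fin_cases i
    · simp; linarith
    · simp; ring)
  have b := hli 1 0 (by
    ext i; fin_cases i
    · simpa using a0.2
    · simpa using a1.2)
  exact one_ne_zero b.1

end
end
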